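/- Suppose a ∈ D satisfies f(a) = 0 and f is differentiable at a with invertible derivative Df(a) (this guarantees that a is an isolated zero of f and that the Brouwer degree of f in a small neighbourhood of a is nonzero). Then there exists ε₁ ∈ (0, ε_f) such that for every ε with 0 < |ε| < ε₁ there is a T-periodic differentiable function x(·,ε) : ℝ → D satisfying x'(t,ε) = ε·F(t, x(t,ε)) + ε²·R(t, x(t,ε), ε) for all t ∈ ℝ, and x(0,ε) → a as ε → 0. -/

import Mathlib

open Set Filter

section NoRetraction

open MeasureTheory Module Metric

variable {E : Type*} [NormedAddCommGroup E] [InnerProductSpace ℝ E] [FiniteDimensional ℝ E]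

lemma det_id_add_smul_eq_sum_lagrange (s : Finset ℝ) (hs : finrank ℝ E < s.card)
    (A : E →L[ℝ] E) (t : ℝ) :
    (ContinuousLinearMap.id ℝ E + t • A).det =
      ∑ i ∈ s, (ContinuousLinearMap.id ℝ E + i • A).det * (Lagrange.basis s id i).eval t := by
  classical
  set b := finBasis ℝ E
  set M := LinearMap.toMatrix b b (A : E →ₗ[ℝ] E)
  set P : Polynomial ℝ :=
    ((Polynomial.X : Polynomial ℝ) • M.map Polynomial.C +
      (1 : Matrix _ _ ℝ).map Polynomial.C).det
  have hP : ∀ r : ℝ, P.eval r = (ContinuousLinearMap.id ℝ E + r • A).det := by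
    intro r
    have h : (ContinuousLinearMap.id ℝ E + r • A).det = (1 + r • M).det := by
      rw [ContinuousLinearMap.det, ← LinearMap.det_toMatrix b]
      congr 1
      simp [M]
    rw [h, ← Polynomial.coe_evalRingHom, RingHom.map_det]
    congr 1
    ext i j
    by_cases hij : i = j <;> simp [hij, add_comm] <;> ring
  have hdeg : P.degree < s.card := by
    refine lt_of_le_of_lt Polynomial.degree_le_natDegree ?_
    have := Polynomial.natDegree_det_X_add_C_le M (1 : Matrix _ _ ℝ)
    rw [Fintype.card_fin] at this
    exact_mod_cast lt_of_le_of_lt this hs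
  have h := Lagrange.eq_interpolate (s := s) (v := id) (injOn_id _) hdeg
  have h2 := congrArg (Polynomial.eval t) h
  rw [hP, Lagrange.interpolate_apply, Polynomial.eval_finsetSum] at h2
  rw [h2]
  refine Finset.sum_congr rfl fun i _ => ?_
  rw [Polynomial.eval_mul, Polynomial.eval_C, id, hP]

lemma det_id_add_pos_of_opNorm_lt_one (A : E →L[ℝ] E) (hA : ‖A‖ < 1) :
    0 < (ContinuousLinearMap.id ℝ E + A).det := by
  have hne : ∀ s ∈ Icc (0 : ℝ) 1, (ContinuousLinearMap.id ℝ E + s • A).det ≠ 0 := by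
    intro s hs h0
    obtain ⟨v, hv, hv0⟩ :=
      (Submodule.ne_bot_iff _).1 (bot_lt_iff_ne_bot.1 (LinearMap.bot_lt_ker_of_det_eq_zero h0))
    have hv' : v + s • A v = 0 := by simpa using hv
    have h1 : ‖v‖ = s * ‖A v‖ := by
      have := congrArg norm (eq_neg_of_add_eq_zero_left hv')
      rwa [norm_neg, norm_smul, Real.norm_of_nonneg hs.1] at this
    have h2 := A.le_opNorm v
    have h3 : 0 < ‖v‖ := norm_pos_iff.2 hv0
    nlinarith [hs.1, hs.2, norm_nonneg (A v)]
  have hc : ContinuousOn (fun s : ℝ => (ContinuousLinearMap.id ℝ E + s • A).det) (Icc 0 1) :=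
    (ContinuousLinearMap.continuous_det.comp (by fun_prop)).continuousOn
  by_contra! h
  obtain ⟨s, hs, h0⟩ := intermediate_value_Icc' zero_le_one hc
    (show (0 : ℝ) ∈ Icc _ _ from ⟨by simpa using h, by
      simp [ContinuousLinearMap.det]⟩)
  exact hne s hs h0

lemma image_ball_id_add_of_contracting {v : E → E} {K : NNReal} (hK : K < 1)
    (hv : LipschitzWith K v) (h0 : ∀ x, 1 ≤ ‖x‖ → v x = 0) :
    InjOn (fun x => x + v x) univ ∧ (fun x => x + v x) '' ball 0 1 = ball 0 1 := by
  have hinj : ∀ x y, x + v x = y + v y → x = y := by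
    intro x y h
    have h1 := hv.dist_le_mul x y
    rw [dist_eq_norm, dist_eq_norm] at h1
    have h2 : v x - v y = -(x - y) := by
      rw [sub_eq_iff_eq_add]
      have : v x = y + v y - x := by rw [← h]; abel
      rw [this]; abel
    rw [h2, norm_neg] at h1
    have h3 : (K : ℝ) < 1 := by exact_mod_cast hK
    have : ‖x - y‖ = 0 := by nlinarith [norm_nonneg (x - y)]
    exact sub_eq_zero.1 (norm_eq_zero.1 this)
  refine ⟨fun x _ y _ h => hinj x y h, Subset.antisymm ?_ ?_⟩
  · rintro _ ⟨x, hx, rfl⟩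
    by_contra hn
    have h1 : v (x + v x) = 0 := h0 _ (by simpa using hn)
    have h2 : x + v x = x := hinj _ _ (by rw [h1, add_zero])
    exact hn (by simpa only [h2] using hx)
  · intro y hy
    have hc : ContractingWith K (fun x => y - v x) := by
      refine ⟨hK, LipschitzWith.of_dist_le_mul fun x z => ?_⟩
      rw [dist_sub_left]
      exact hv.dist_le_mul x z
    have hfix : y - v (hc.fixedPoint _) = hc.fixedPoint _ := hc.fixedPoint_isFixedPt
    set x := hc.fixedPoint (fun x => y - v x)
    have hxy : x + v x = y := sub_eq_iff_eq_add.1 hfix |>.symm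
    refine ⟨x, ?_, hxy⟩
    by_contra hn
    have h1 : v x = 0 := h0 _ (by simpa using hn)
    rw [h1, add_zero] at hxy
    exact hn (hxy ▸ hy)

/-- There is no Lipschitz retraction `x ↦ x + u x` of the closed unit ball onto the sphere. -/
theorem exists_norm_add_ne_one_of_lipschitz {u : E → E} {K : NNReal} (hu : LipschitzWith K u)
    (h0 : ∀ x, 1 ≤ ‖x‖ → u x = 0) : ∃ x ∈ ball (0 : E) 1, ‖x + u x‖ ≠ 1 := by
  by_contra! hall
  let _ : MeasurableSpace E := borel E
  have _ : BorelSpace E := ⟨rfl⟩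
  set μ : Measure E := Measure.hausdorffMeasure (finrank ℝ E)
  set B : Set E := ball 0 1
  set S : Set E := B ∩ {x | DifferentiableAt ℝ u x}
  have hS : MeasurableSet S :=
    measurableSet_ball.inter (measurableSet_of_differentiableAt ℝ u)
  have hnull : μ (B \ S) = 0 := by
    refine measure_mono_null ?_ (hu.ae_differentiableAt (μ := μ))
    rintro x ⟨hx, hxS⟩ hd
    exact hxS ⟨hx, hd⟩
  have hBfin : μ B ≠ ⊤ := measure_ball_lt_top.ne
  have hBpos : 0 < μ B := measure_ball_pos μ 0 one_pos
  have key : ∀ t : ℝ, 0 < t → t * K < 1 →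
      IntegrableOn (fun x => (ContinuousLinearMap.id ℝ E + t • fderiv ℝ u x).det) S μ ∧
      ∫ x in S, (ContinuousLinearMap.id ℝ E + t • fderiv ℝ u x).det ∂μ = μ.real B := by
    intro t ht htK
    set φ : E → E := fun x => x + t • u x
    have hK' : t.toNNReal * K < 1 := by
      rw [← NNReal.coe_lt_coe]; simpa [ht.le] using htK
    have hv : LipschitzWith (t.toNNReal * K) (fun x => t • u x) := by
      refine LipschitzWith.of_dist_le_mul fun x y => ?_
      rw [dist_smul₀, NNReal.coe_mul, Real.coe_toNNReal _ ht.le, Real.norm_of_nonneg ht.le,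
        mul_assoc]
      exact mul_le_mul_of_nonneg_left (hu.dist_le_mul x y) ht.le
    obtain ⟨hinj, himg⟩ := image_ball_id_add_of_contracting hK' hv
      (fun x hx => by simp [h0 x hx])
    have hφ : LipschitzWith (1 + t.toNNReal * K) φ := LipschitzWith.id.add hv
    have hd : ∀ x ∈ S, HasFDerivWithinAt φ (ContinuousLinearMap.id ℝ E + t • fderiv ℝ u x) S x :=
      fun x hx => ((hasFDerivAt_id x).add (hx.2.hasFDerivAt.const_smul t)).hasFDerivWithinAt
    have hinjS : InjOn φ S := hinj.mono (subset_univ _)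
    have hpos : ∀ x ∈ S, |(ContinuousLinearMap.id ℝ E + t • fderiv ℝ u x).det| =
        (ContinuousLinearMap.id ℝ E + t • fderiv ℝ u x).det := by
      intro x _
      refine abs_of_pos (det_id_add_pos_of_opNorm_lt_one _ (lt_of_le_of_lt ?_ htK))
      rw [norm_smul, Real.norm_of_nonneg ht.le]
      exact mul_le_mul_of_nonneg_left (norm_fderiv_le_of_lipschitz ℝ hu) ht.le
    have hμ : μ (φ '' S) = μ B := by
      refine le_antisymm (measure_mono ?_) ?_
      · calc φ '' S ⊆ φ '' B := image_mono inter_subset_left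
          _ = B := himg
      · have hN : μ (φ '' (B \ S)) = 0 := by
          have := hφ.hausdorffMeasure_image_le (d := finrank ℝ E) (by positivity) (B \ S)
          rw [hnull, mul_zero] at this
          exact le_antisymm this bot_le
        calc μ B = μ (φ '' B) := by rw [himg]
          _ ≤ μ (φ '' S ∪ φ '' (B \ S)) := by
            refine measure_mono ?_
            rw [← image_union]
            exact image_mono (fun x hx => by
              by_cases h : x ∈ S
              · exact Or.inl h
              · exact Or.inr ⟨hx, h⟩)
          _ ≤ μ (φ '' S) + μ (φ '' (B \ S)) := measure_union_le _ _
          _ = μ (φ '' S) := by rw [hN, add_zero]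
    constructor
    · have h := (integrableOn_image_iff_integrableOn_abs_det_fderiv_smul μ hS hd hinjS
        (fun _ => (1 : ℝ))).1 (integrableOn_const (by rw [hμ]; exact hBfin))
      refine h.congr_fun (fun x hx => ?_) hS
      simp only [smul_eq_mul, mul_one]
      exact hpos x hx
    · have h := integral_image_eq_integral_abs_det_fderiv_smul μ hS hd hinjS (fun _ => (1 : ℝ))
      rw [setIntegral_const, smul_eq_mul, mul_one, measureReal_def, hμ] at h
      rw [measureReal_def, h]
      refine setIntegral_congr_fun hS (fun x hx => ?_)
      simp only [smul_eq_mul, mul_one]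
      exact (hpos x hx).symm
  have hdet0 : ∀ x ∈ S, (ContinuousLinearMap.id ℝ E + (1 : ℝ) • fderiv ℝ u x).det = 0 := by
    rintro x ⟨hxB, hxd⟩
    set A := ContinuousLinearMap.id ℝ E + (1 : ℝ) • fderiv ℝ u x
    have hA : HasFDerivAt (fun y => y + u y) A x := by
      simp only [A, one_smul]
      exact (hasFDerivAt_id x).add hxd.hasFDerivAt
    have hsq := hA.norm_sq
    have hconst : HasFDerivAt (fun y => ‖y + u y‖ ^ 2) (0 : E →L[ℝ] ℝ) x := by
      refine (hasFDerivAt_const (1 : ℝ) x).congr_of_eventuallyEq ?_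
      filter_upwards [isOpen_ball.mem_nhds hxB] with y hy
      rw [hall y hy, one_pow]
    have horth : ∀ w, inner ℝ (x + u x) (A w) = 0 := by
      intro w
      have := congrArg (fun l : E →L[ℝ] ℝ => l w) (hsq.unique hconst)
      rw [inner_add_left]
      simp at this
      linarith
    by_contra hdet
    have hsurj : Function.Surjective A := by
      have := (LinearEquiv.ofIsUnitDet (f := (A : E →ₗ[ℝ] E)) (v := finBasis ℝ E)
        (v' := finBasis ℝ E) (by
          rw [LinearMap.det_toMatrix]; exact isUnit_iff_ne_zero.2 hdet)).surjective
      exact this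
    obtain ⟨w, hw⟩ := hsurj (x + u x)
    have h1 := horth w
    rw [hw, inner_self_eq_zero] at h1
    have h2 := hall x hxB
    rw [h1, norm_zero] at h2
    exact zero_ne_one h2
  obtain ⟨s, hsub, hcard⟩ := (Ioo_infinite (show (0 : ℝ) < 1 / (K + 1) by positivity)
    ).exists_subset_card_eq (finrank ℝ E + 1)
  have hsne : s.Nonempty := by rw [← Finset.card_pos]; omega
  have hs : ∀ i ∈ s, 0 < i ∧ i * K < 1 := by
    intro i hi
    obtain ⟨h1, h2⟩ := hsub hi
    rw [lt_div_iff₀ (by positivity)] at h2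
    exact ⟨h1, by nlinarith⟩
  have hzero : (0 : ℝ) = μ.real B := by
    calc (0 : ℝ) = ∫ x in S, (ContinuousLinearMap.id ℝ E + (1 : ℝ) • fderiv ℝ u x).det ∂μ := by
          rw [setIntegral_congr_fun hS hdet0]; simp
      _ = ∫ x in S, ∑ i ∈ s, (ContinuousLinearMap.id ℝ E + i • fderiv ℝ u x).det *
            (Lagrange.basis s id i).eval 1 ∂μ := by
          congr 1; ext x
          exact det_id_add_smul_eq_sum_lagrange s (by omega) _ 1
      _ = ∑ i ∈ s, μ.real B * (Lagrange.basis s id i).eval 1 := by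
          rw [integral_finsetSum]
          · refine Finset.sum_congr rfl fun i hi => ?_
            rw [integral_mul_const, (key i (hs i hi).1 (hs i hi).2).2]
          · intro i hi
            exact (key i (hs i hi).1 (hs i hi).2).1.mul_const _
      _ = μ.real B := by
          rw [← Finset.mul_sum, ← Polynomial.eval_finsetSum,
            Lagrange.sum_basis (injOn_id _) hsne, Polynomial.eval_one, mul_one]
  exact (ENNReal.toReal_pos hBpos.ne' hBfin).ne hzero

end NoRetraction

section Zero

open Metric

variable {E : Type*} [NormedAddCommGroup E] [InnerProductSpace ℝ E] [FiniteDimensional ℝ E]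
omit [FiniteDimensional ℝ E] in
lemma lipschitzWith_indicator_closedBall {w : E → E} {K : NNReal}
    (hw : LipschitzOnWith K w (closedBall 0 1)) (h0 : ∀ x, ‖x‖ = 1 → w x = 0) :
    LipschitzWith (2 * K) ((closedBall 0 1).indicator w) := by
  have hcross : ∀ x y : E, ‖x‖ ≤ 1 → 1 < ‖y‖ → ‖w x‖ ≤ 2 * K * dist x y := by
    intro x y hx hy
    have hy0 : ‖y‖ ≠ 0 := by positivity
    have hz : ‖‖y‖⁻¹ • y‖ = 1 := by
      rw [norm_smul, norm_inv, norm_norm, inv_mul_cancel₀ hy0]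
    have hyz : ‖y - ‖y‖⁻¹ • y‖ = ‖y‖ - 1 := by
      have h1 : y - ‖y‖⁻¹ • y = (1 - ‖y‖⁻¹) • y := by rw [sub_smul, one_smul]
      rw [h1, norm_smul, Real.norm_of_nonneg (sub_nonneg.2 (inv_le_one_of_one_le₀ hy.le)),
        sub_mul, one_mul, inv_mul_cancel₀ hy0]
    have h2 := hw.dist_le_mul x (by simpa using hx) (‖y‖⁻¹ • y) (by simp [hz])
    rw [h0 _ hz, dist_zero_right] at h2
    have h3 : dist x (‖y‖⁻¹ • y) ≤ 2 * dist x y := by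
      have h4 := dist_triangle x y (‖y‖⁻¹ • y)
      have h5 := norm_sub_norm_le y x
      rw [dist_eq_norm y, hyz] at h4
      rw [← dist_eq_norm, dist_comm] at h5
      linarith
    calc ‖w x‖ ≤ K * dist x (‖y‖⁻¹ • y) := h2
      _ ≤ K * (2 * dist x y) := by gcongr
      _ = 2 * K * dist x y := by ring
  refine LipschitzWith.of_dist_le_mul fun x y => ?_
  push_cast
  rcases le_or_gt ‖x‖ 1 with hx | hx <;> rcases le_or_gt ‖y‖ 1 with hy | hy
  · rw [indicator_of_mem (by simpa using hx), indicator_of_mem (by simpa using hy)]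
    refine (hw.dist_le_mul x (by simpa using hx) y (by simpa using hy)).trans ?_
    have : 0 ≤ K * dist x y := by positivity
    linarith
  · rw [indicator_of_mem (by simpa using hx), indicator_of_notMem (by simpa using hy),
      dist_zero_right]
    exact hcross x y hx hy
  · rw [indicator_of_notMem (by simpa using hx), indicator_of_mem (by simpa using hy),
      dist_zero_left, dist_comm]
    exact hcross y x hy hx
  · rw [indicator_of_notMem (by simpa using hx), indicator_of_notMem (by simpa using hy),
      dist_self]
    positivity

omit [FiniteDimensional ℝ E] in
lemma norm_normalize_sub_normalize_le {a b : E} {c : ℝ} (hc : 0 < c) (ha : c ≤ ‖a‖)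
    (hb : b ≠ 0) : ‖‖a‖⁻¹ • a - ‖b‖⁻¹ • b‖ ≤ 2 / c * ‖a - b‖ := by
  have ha0 : 0 < ‖a‖ := hc.trans_le ha
  have hb0 : 0 < ‖b‖ := norm_pos_iff.2 hb
  have h1 : ‖a‖⁻¹ • a - ‖b‖⁻¹ • b = ‖a‖⁻¹ • (a - b) + (‖a‖⁻¹ - ‖b‖⁻¹) • b := by
    rw [smul_sub, sub_smul]; abel
  have h2 : ‖(‖a‖⁻¹ - ‖b‖⁻¹) • b‖ = ‖a‖⁻¹ * |‖b‖ - ‖a‖| := by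
    have h3 : ‖a‖⁻¹ - ‖b‖⁻¹ = ‖a‖⁻¹ * (‖b‖ - ‖a‖) * ‖b‖⁻¹ := by field_simp
    rw [norm_smul, h3, norm_mul, norm_mul, norm_inv, norm_inv, norm_norm, norm_norm,
      mul_assoc, inv_mul_cancel₀ hb0.ne', mul_one, Real.norm_eq_abs]
  have h4 : |‖b‖ - ‖a‖| ≤ ‖a - b‖ := by
    rw [abs_sub_comm]; exact abs_norm_sub_norm_le a b
  have h5 : ‖a‖⁻¹ ≤ c⁻¹ := inv_anti₀ hc ha
  rw [h1]
  calc _ ≤ ‖a‖⁻¹ * ‖a - b‖ + ‖a‖⁻¹ * |‖b‖ - ‖a‖| := by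
        refine (norm_add_le _ _).trans ?_
        rw [h2, norm_smul, norm_inv, norm_norm]
    _ ≤ c⁻¹ * ‖a - b‖ + c⁻¹ * ‖a - b‖ := by gcongr
    _ = 2 / c * ‖a - b‖ := by ring

/-- A form of Brouwer's theorem: a Lipschitz map that is uniformly close to the identity on the
closed unit ball has a zero there. -/
theorem exists_eq_zero_of_norm_sub_le_half {h : E → E} {K : NNReal}
    (hh : LipschitzOnWith K h (closedBall 0 1))
    (hc : ∀ x ∈ closedBall (0 : E) 1, ‖h x - x‖ ≤ 1 / 2) :
    ∃ x ∈ closedBall (0 : E) 1, h x = 0 := by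
  by_contra! hne
  set χ : E → ℝ := fun x => min 1 (2 * (1 - ‖x‖))
  set φ : E → E := fun x => x + χ x • (h x - x)
  have hχ : ∀ x ∈ closedBall (0 : E) 1, 0 ≤ χ x ∧ χ x ≤ 1 := by
    intro x hx
    have : ‖x‖ ≤ 1 := by simpa using hx
    exact ⟨le_min zero_le_one (by linarith), min_le_left _ _⟩
  have hφne : ∀ x ∈ closedBall (0 : E) 1, φ x ≠ 0 := by
    intro x hx h0
    rcases le_or_gt ‖x‖ (1 / 2) with hx2 | hx2
    · have h1 : χ x = 1 := min_eq_left (by linarith)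
      have h2 : φ x = h x := by simp [φ, h1]
      exact hne x hx (h2 ▸ h0)
    · have h1 : ‖x‖ = χ x * ‖h x - x‖ := by
        have := congrArg norm (eq_neg_of_add_eq_zero_left h0)
        rwa [norm_neg, norm_smul, Real.norm_of_nonneg (hχ x hx).1] at this
      have h2 := hc x hx
      nlinarith [hχ x hx, norm_nonneg (h x - x)]
  have hχlip : ∀ x y, |χ x - χ y| ≤ 2 * dist x y := by
    intro x y
    refine (abs_min_sub_min_le_max _ _ _ _).trans (max_le (by simp) ?_)
    have h1 : 2 * (1 - ‖x‖) - 2 * (1 - ‖y‖) = 2 * (‖y‖ - ‖x‖) := by ring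
    rw [h1, abs_mul, abs_two, abs_sub_comm, dist_eq_norm]
    gcongr
    exact abs_norm_sub_norm_le x y
  have hφlip : LipschitzOnWith (K + 3) φ (closedBall 0 1) := by
    refine LipschitzOnWith.of_dist_le_mul fun x hx y hy => ?_
    have h1 : φ x - φ y =
        (x - y) + (χ x • ((h x - h y) - (x - y)) + (χ x - χ y) • (h y - y)) := by
      simp only [φ]; module
    have h2 := hh.dist_le_mul x hx y hy
    have h3 : ‖χ x • ((h x - h y) - (x - y))‖ ≤ 1 * (K * dist x y + dist x y) := by
      rw [norm_smul, Real.norm_of_nonneg (hχ x hx).1]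
      have h4 := norm_sub_le (h x - h y) (x - y)
      rw [← dist_eq_norm (h x), ← dist_eq_norm x] at h4
      exact mul_le_mul (hχ x hx).2 (by linarith) (norm_nonneg _) zero_le_one
    have h5 : ‖(χ x - χ y) • (h y - y)‖ ≤ 2 * dist x y * (1 / 2) := by
      rw [norm_smul]
      exact mul_le_mul (hχlip x y) (hc y hy) (norm_nonneg _) (by positivity)
    rw [dist_eq_norm (φ x), h1]
    refine (norm_add_le _ _).trans ?_
    have h6 := norm_add_le (χ x • ((h x - h y) - (x - y))) ((χ x - χ y) • (h y - y))
    rw [← dist_eq_norm]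
    push_cast
    linarith
  obtain ⟨x₀, hx₀, hmin⟩ := (isCompact_closedBall (0 : E) 1).exists_isMinOn
    ⟨0, by simp⟩ hφlip.continuousOn.norm
  set c := ‖φ x₀‖
  have hcpos : 0 < c := norm_pos_iff.2 (hφne x₀ hx₀)
  set w : E → E := fun x => ‖φ x‖⁻¹ • φ x - x
  have hw : LipschitzOnWith (Real.toNNReal (2 / c * (K + 3) + 1)) w (closedBall 0 1) := by
    refine LipschitzOnWith.of_dist_le_mul fun x hx y hy => ?_
    rw [Real.coe_toNNReal _ (by positivity), dist_eq_norm]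
    have h1 : w x - w y = (‖φ x‖⁻¹ • φ x - ‖φ y‖⁻¹ • φ y) - (x - y) := by
      simp only [w]; abel
    have h2 := norm_normalize_sub_normalize_le hcpos (isMinOn_iff.1 hmin x hx) (hφne y hy)
    have h3 := hφlip.dist_le_mul x hx y hy
    rw [h1]
    refine (norm_sub_le _ _).trans ?_
    rw [← dist_eq_norm x y]
    rw [← dist_eq_norm (φ x)] at h2
    push_cast at h3
    have h4 : 2 / c * dist (φ x) (φ y) ≤ 2 / c * ((K + 3) * dist x y) := by gcongr
    linarith
  have hw0 : ∀ x, ‖x‖ = 1 → w x = 0 := by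
    intro x hx
    have h1 : χ x = 0 := by simp [χ, hx]
    simp [w, φ, h1, hx]
  obtain ⟨x, hx, hx1⟩ := exists_norm_add_ne_one_of_lipschitz
    (lipschitzWith_indicator_closedBall hw hw0) (fun x hx => by
      rcases hx.eq_or_lt with h1 | h1
      · rw [indicator_apply_eq_zero]
        exact fun _ => hw0 x h1.symm
      · exact indicator_of_notMem (by simpa using h1) _)
  refine hx1 ?_
  have hx' := ball_subset_closedBall hx
  rw [indicator_of_mem hx', add_sub_cancel, norm_smul, norm_inv, norm_norm,
    inv_mul_cancel₀ (norm_ne_zero_iff.2 (hφne x hx'))]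

end Zero

section Averaging

open Metric

variable {E : Type*} [NormedAddCommGroup E]

section FixedPoint

variable [InnerProductSpace ℝ E] [FiniteDimensional ℝ E]

/-- Lipschitz maps `P` with `P z = z + ε f(z) + O(ε²)` have fixed points near any zero of `f` at
which `f` has an invertible derivative. -/
theorem exists_fixedPoint_of_norm_sub_le {f : E → E} {a : E} (Df : E ≃L[ℝ] E) (hfa : f a = 0)
    (hdf : HasFDerivAt f (Df : E →L[ℝ] E) a) {C r₁ : ℝ} (hC : 0 ≤ C) (hr₁ : 0 < r₁)
    {ρ : ℝ} (hρ : 0 < ρ) :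
    ∃ δ > 0, ∀ ε : ℝ, 0 < |ε| → |ε| < δ → ∀ (P : E → E) (K : NNReal),
      LipschitzOnWith K P (closedBall a r₁) →
      (∀ z ∈ closedBall a r₁, ‖P z - z - ε • f z‖ ≤ C * ε ^ 2) →
      ∃ z ∈ closedBall a r₁, dist z a ≤ ρ ∧ P z = z := by
  set N := ‖(Df.symm : E →L[ℝ] E)‖ + 1
  have hN : 0 < N := by positivity
  have hlit := (hasFDerivAt_iff_isLittleO_nhds_zero.1 hdf).bound
    (show 0 < 1 / (4 * N) by positivity)
  obtain ⟨r₂, hr₂, hball⟩ := Metric.nhds_basis_closedBall.eventually_iff.1 hlit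
  set r := min ρ (min r₁ r₂)
  have hr : 0 < r := lt_min hρ (lt_min hr₁ hr₂)
  have hrρ : r ≤ ρ := min_le_left _ _
  have hrr₁ : r ≤ r₁ := (min_le_right _ _).trans (min_le_left _ _)
  have hrr₂ : r ≤ r₂ := (min_le_right _ _).trans (min_le_right _ _)
  refine ⟨r / (4 * N * (C + 1)), by positivity, fun ε hε0 hε P K hP hPf => ?_⟩
  have hεne : ε ≠ 0 := abs_pos.1 hε0
  have hdist : ∀ x ∈ closedBall (0 : E) 1, dist (a + r • x) a ≤ r := by
    intro x hx
    rw [dist_self_add_left, norm_smul, Real.norm_of_nonneg hr.le]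
    have : ‖x‖ ≤ 1 := by simpa using hx
    nlinarith
  have hmem : ∀ x ∈ closedBall (0 : E) 1, a + r • x ∈ closedBall a r₁ :=
    fun x hx => (hdist x hx).trans hrr₁
  set q : E → E := fun x => a + r • x
  have hq : LipschitzWith r.toNNReal q := by
    refine LipschitzWith.of_dist_le_mul fun x y => ?_
    rw [dist_add_left, dist_smul₀, Real.norm_of_nonneg hr.le, Real.coe_toNNReal _ hr.le]
  set l : E →L[ℝ] E := (ε * r)⁻¹ • (Df.symm : E →L[ℝ] E)
  have hlip : LipschitzOnWith (‖l‖₊ * (K * r.toNNReal + r.toNNReal))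
      (fun x => l (P (q x) - q x)) (closedBall 0 1) :=
    l.lipschitz.comp_lipschitzOnWith
      ((hP.comp hq.lipschitzOnWith hmem).sub hq.lipschitzOnWith)
  obtain ⟨x, hx, hx0⟩ := exists_eq_zero_of_norm_sub_le_half hlip (fun x hx => by
    have h1 : l (P (q x) - q x) - x = Df.symm
        ((ε * r)⁻¹ • (P (q x) - q x - ε • f (q x)) +
          r⁻¹ • (f (q x) - Df (r • x))) := by
      have h2 : (ε * r)⁻¹ • (P (q x) - q x - ε • f (q x)) + r⁻¹ • (f (q x) - Df (r • x)) =
          (ε * r)⁻¹ • (P (q x) - q x) - Df x := by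
        rw [map_smul, smul_sub r⁻¹, smul_smul r⁻¹, inv_mul_cancel₀ hr.ne', one_smul,
          smul_sub (ε * r)⁻¹ _ (ε • _), smul_smul,
          show (ε * r)⁻¹ * ε = r⁻¹ by field_simp]
        abel
      rw [h2, map_sub Df.symm, Df.symm_apply_apply, map_smul Df.symm]
      simp [l]
    have h3 : ‖(ε * r)⁻¹ • (P (q x) - q x - ε • f (q x))‖ ≤ 1 / (4 * N) := by
      rw [norm_smul, norm_inv, norm_mul, Real.norm_eq_abs, Real.norm_of_nonneg hr.le]
      refine (mul_le_mul_of_nonneg_left (hPf _ (hmem x hx)) (by positivity)).trans ?_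
      rw [lt_div_iff₀ (by positivity)] at hε
      rw [← sq_abs, show (|ε| * r)⁻¹ * (C * |ε| ^ 2) = C * |ε| / r by field_simp,
        div_le_div_iff₀ hr (by positivity)]
      nlinarith [mul_pos hε0 hN]
    have h4 : ‖r⁻¹ • (f (q x) - Df (r • x))‖ ≤ 1 / (4 * N) := by
      have hrx : ‖r • x‖ ≤ r := by simpa [q] using hdist x hx
      have h5 := hball (show r • x ∈ closedBall 0 r₂ by simpa using hrx.trans hrr₂)
      rw [hfa, sub_zero] at h5
      rw [norm_smul, norm_inv, Real.norm_of_nonneg hr.le, inv_mul_le_iff₀ hr, mul_comm r]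
      exact h5.trans (mul_le_mul_of_nonneg_left hrx (by positivity))
    rw [h1]
    refine ((Df.symm : E →L[ℝ] E).le_opNorm _).trans ?_
    have h6 := (norm_add_le _ _).trans (add_le_add h3 h4)
    calc _ ≤ N * (1 / (4 * N) + 1 / (4 * N)) :=
          mul_le_mul (by simp [N]) h6 (norm_nonneg _) hN.le
      _ = 1 / 2 := by field_simp; norm_num)
  refine ⟨q x, hmem x hx, (hdist x hx).trans hrρ, ?_⟩
  have h7 : Df.symm (P (q x) - q x) = 0 := by
    have h8 : (ε * r)⁻¹ • Df.symm (P (q x) - q x) = 0 := hx0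
    exact (smul_eq_zero.1 h8).resolve_left (inv_ne_zero (mul_ne_zero hεne hr.ne'))
  exact sub_eq_zero.1 ((map_eq_zero_iff _ Df.symm.injective).1 h7)

end FixedPoint

variable [NormedSpace ℝ E]

/-- The Picard–Lindelöf flow of a vector field of small norm, with the displacement bound and
Lipschitz dependence of the time-`T` map on the initial value. -/
theorem exists_lipschitz_flow_of_norm_lt [CompleteSpace E] {V : ℝ → E → E} {a : E}
    {T M r : ℝ} {K : NNReal} (hT : 0 ≤ T) (hM : 0 ≤ M) (hr : 0 ≤ r)
    (hlip : ∀ t ∈ Icc 0 T, LipschitzOnWith K (V t) (closedBall a (2 * r)))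
    (hcont : ∀ x ∈ closedBall a (2 * r), ContinuousOn (V · x) (Icc 0 T))
    (hbound : ∀ t ∈ Icc 0 T, ∀ x ∈ closedBall a (2 * r), ‖V t x‖ < M) (hMT : M * T ≤ r) :
    ∃ α : E → ℝ → E, (∀ z ∈ closedBall a r, α z 0 = z ∧
      (∀ t ∈ Icc 0 T, HasDerivWithinAt (α z) (V t (α z t)) (Icc 0 T) t) ∧
      ∀ t ∈ Icc 0 T, ‖α z t - z‖ ≤ M * t) ∧
      ∃ L : NNReal, LipschitzOnWith L (α · T) (closedBall a r) := by
  have hpl : IsPicardLindelof V (⟨0, le_rfl, hT⟩ : Icc 0 T) a (2 * r.toNNReal) r.toNNReal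
      M.toNNReal K := by
    have h2r : ((2 * r.toNNReal : NNReal) : ℝ) = 2 * r := by simp [hr]
    constructor
    · rwa [h2r]
    · rwa [h2r]
    · rw [h2r, Real.coe_toNNReal _ hM]
      exact fun t ht x hx => (hbound t ht x hx).le
    · rw [h2r, Real.coe_toNNReal _ hM, Real.coe_toNNReal _ hr]
      simp only [sub_zero, sub_self, max_eq_left hT]
      linarith
  obtain ⟨α, hα, L, hL⟩ := hpl.exists_forall_mem_closedBall_eq_hasDerivWithinAt_lipschitzOnWith
  rw [Real.coe_toNNReal _ hr] at hα hL
  refine ⟨α, fun z hz => ⟨(hα z hz).1, (hα z hz).2, ?_⟩, L, hL T ⟨hT, le_rfl⟩⟩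
  obtain ⟨h0, hd⟩ := hα z hz
  refine image_norm_le_of_norm_deriv_right_lt_deriv_boundary' (f := fun t => α z t - z)
    (f' := fun t => V t (α z t)) (B := fun t => M * t) (B' := fun _ => M) ?_ ?_ ?_ ?_ ?_ ?_
  · exact (HasDerivWithinAt.continuousOn hd).sub continuousOn_const
  · intro t ht
    exact ((hd t (Ico_subset_Icc_self ht)).mono_of_mem_nhdsWithin
      (Icc_mem_nhdsGE_of_mem ht)).sub_const z
  · have : α z 0 = z := h0
    simp [this]
  · fun_prop
  · intro t _
    simpa using ((hasDerivAt_id t).const_mul M).hasDerivWithinAt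
  · intro t ht heq
    refine hbound t (Ico_subset_Icc_self ht) _ ?_
    have h1 : dist (α z t) z ≤ r := by
      rw [dist_eq_norm, heq]
      nlinarith [ht.2]
    have h2 : dist z a ≤ r := hz
    exact (dist_triangle _ z _).trans (by linarith)

/-- A solution of a `T`-periodic equation on `[0, T]` with equal end values extends to a
`T`-periodic solution on `ℝ`. -/
theorem exists_periodic_solution {V : ℝ → E → E} {T : ℝ} (hT : 0 < T)
    (hper : ∀ t x, V (t + T) x = V t x) {y : ℝ → E}
    (hy : ∀ t ∈ Icc 0 T, HasDerivWithinAt y (V t (y t)) (Icc 0 T) t) (hyT : y T = y 0) :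
    ∃ x : ℝ → E, x 0 = y 0 ∧ (∀ t, x t ∈ y '' Icc 0 T) ∧ Function.Periodic x T ∧
      ∀ t, HasDerivAt x (V t (x t)) t := by
  set x : ℝ → E := fun t => y (toIcoMod hT 0 t)
  have hV : ∀ (k : ℤ) t z, V (t - k * T) z = V t z := fun k t z =>
    Function.Periodic.sub_int_mul_eq (f := fun t => V t z) (fun t => hper t z) k
  have hx : ∀ k : ℤ, ∀ t ∈ Icc (k * T) ((k + 1) * T), x t = y (t - k * T) := by
    intro k t ht
    rcases ht.2.eq_or_lt with h | h
    · have h1 : toIcoMod hT 0 t = 0 :=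
        (toIcoMod_eq_iff hT).2 ⟨by simp [hT], k + 1, by simp [h]⟩
      have h2 : t - k * T = T := by rw [h]; ring
      rw [h2, hyT]
      simp only [x, h1]
    · have h1 : toIcoMod hT 0 t = t - k * T :=
        (toIcoMod_eq_iff hT).2 ⟨⟨by linarith [ht.1], by linarith⟩, k, by simp⟩
      simp only [x, h1]
  have hd : ∀ k : ℤ, ∀ t ∈ Icc (k * T) ((k + 1) * T),
      HasDerivWithinAt x (V t (x t)) (Icc (k * T) ((k + 1) * T)) t := by
    intro k t ht
    have hmaps : MapsTo (fun s => s - k * T) (Icc (k * T) ((k + 1) * T)) (Icc 0 T) :=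
      fun s hs => ⟨by linarith [hs.1], by linarith [hs.2]⟩
    have h1 := (hy _ (hmaps ht)).scomp t
      (((hasDerivAt_id t).sub_const ((k : ℝ) * T)).hasDerivWithinAt) hmaps
    rw [one_smul, hV, ← hx k t ht] at h1
    exact h1.congr (fun s hs => hx k s hs) (hx k t ht)
  refine ⟨x, ?_, ?_, ?_, ?_⟩
  · simpa using hx 0 0 (by simp [hT.le])
  · intro t
    have := toIcoMod_mem_Ico hT 0 t
    rw [zero_add] at this
    exact ⟨_, Ico_subset_Icc_self this, rfl⟩
  · intro t
    simp only [x, toIcoMod_add_right]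
  · intro t
    have hright : HasDerivWithinAt x (V t (x t)) (Ici t) t := by
      have h1 : (⌊t / T⌋ : ℝ) * T ≤ t := (le_div_iff₀ hT).1 (Int.floor_le _)
      have h2 : t < (⌊t / T⌋ + 1) * T := (div_lt_iff₀ hT).1 (Int.lt_floor_add_one _)
      exact (hd _ t ⟨h1, h2.le⟩).mono_of_mem_nhdsWithin (Icc_mem_nhdsGE_of_mem ⟨h1, h2⟩)
    have hleft : HasDerivWithinAt x (V t (x t)) (Iic t) t := by
      have h1 : ((⌈t / T⌉ - 1 : ℤ) : ℝ) * T < t := by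
        rw [← lt_div_iff₀ hT]
        push_cast
        linarith [Int.ceil_lt_add_one (t / T)]
      have h2 : t ≤ (((⌈t / T⌉ - 1 : ℤ) : ℝ) + 1) * T := by
        rw [← div_le_iff₀ hT]
        push_cast
        linarith [Int.le_ceil (t / T)]
      exact (hd _ t ⟨h1.le, h2⟩).mono_of_mem_nhdsWithin (Icc_mem_nhdsLE_of_mem ⟨h1, h2⟩)
    have h := hleft.union hright
    rwa [Iic_union_Ici, hasDerivWithinAt_univ] at h

/-- The flow of `ε F + ε² R` near `a`, and the first-order expansion in `ε` of its time-`T` map. -/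
theorem exists_flow_norm_sub_le [CompleteSpace E] {F G : ℝ → E → E} {a : E} {T M L r ε : ℝ}
    (hT : 0 ≤ T) (hM : 0 < M) (hL : 0 ≤ L) (hr : 0 ≤ r)
    (hFlip : ∀ t ∈ Icc 0 T, ∀ x ∈ closedBall a (2 * r), ∀ y ∈ closedBall a (2 * r),
      ‖F t x - F t y‖ ≤ L * ‖x - y‖)
    (hGlip : ∀ t ∈ Icc 0 T, ∀ x ∈ closedBall a (2 * r), ∀ y ∈ closedBall a (2 * r),
      ‖G t x - G t y‖ ≤ L * ‖x - y‖)
    (hFcont : ∀ x ∈ closedBall a (2 * r), Continuous (F · x))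
    (hGcont : ∀ x ∈ closedBall a (2 * r), Continuous (G · x))
    (hFM : ∀ t ∈ Icc 0 T, ∀ x ∈ closedBall a (2 * r), ‖F t x‖ ≤ M)
    (hGM : ∀ t ∈ Icc 0 T, ∀ x ∈ closedBall a (2 * r), ‖G t x‖ ≤ M)
    (hε0 : 0 < |ε|) (hε1 : |ε| ≤ 1) (hεr : 3 * |ε| * M * T ≤ r) :
    ∃ α : E → ℝ → E, (∀ z ∈ closedBall a r, α z 0 = z ∧
      (∀ t ∈ Icc 0 T,
        HasDerivWithinAt (α z) (ε • F t (α z t) + ε ^ 2 • G t (α z t)) (Icc 0 T) t) ∧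
      (∀ t ∈ Icc 0 T, α z t ∈ closedBall a (2 * r)) ∧
      ‖α z T - z - ε • ∫ t in (0 : ℝ)..T, F t z‖ ≤ (3 * L * M * T + M) * T * ε ^ 2) ∧
      ∃ K : NNReal, LipschitzOnWith K (α · T) (closedBall a r) := by
  have hεsq : ε ^ 2 ≤ |ε| := by rw [← sq_abs]; nlinarith
  set V : ℝ → E → E := fun t x => ε • F t x + ε ^ 2 • G t x
  have hVlip : ∀ t ∈ Icc 0 T,
      LipschitzOnWith (2 * L).toNNReal (V t) (closedBall a (2 * r)) := by
    intro t ht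
    refine LipschitzOnWith.of_dist_le_mul fun x hx y hy => ?_
    rw [Real.coe_toNNReal _ (by positivity), dist_eq_norm, dist_eq_norm]
    have h1 : V t x - V t y = ε • (F t x - F t y) + ε ^ 2 • (G t x - G t y) := by
      simp only [V]; module
    rw [h1]
    refine (norm_add_le _ _).trans ?_
    rw [norm_smul, norm_smul, Real.norm_eq_abs, Real.norm_of_nonneg (sq_nonneg ε)]
    have h2 : |ε| * ‖F t x - F t y‖ ≤ 1 * (L * ‖x - y‖) :=
      mul_le_mul hε1 (hFlip t ht x hx y hy) (norm_nonneg _) zero_le_one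
    have h3 : ε ^ 2 * ‖G t x - G t y‖ ≤ 1 * (L * ‖x - y‖) :=
      mul_le_mul (hεsq.trans hε1) (hGlip t ht x hx y hy) (norm_nonneg _) zero_le_one
    linarith
  have hVM : ∀ t ∈ Icc 0 T, ∀ x ∈ closedBall a (2 * r), ‖V t x‖ < 3 * |ε| * M := by
    intro t ht x hx
    refine (norm_add_le _ _).trans_lt ?_
    rw [norm_smul, norm_smul, Real.norm_eq_abs, Real.norm_of_nonneg (sq_nonneg ε)]
    have h2 : |ε| * ‖F t x‖ ≤ |ε| * M :=
      mul_le_mul_of_nonneg_left (hFM t ht x hx) hε0.le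
    have h3 : ε ^ 2 * ‖G t x‖ ≤ |ε| * M :=
      mul_le_mul hεsq (hGM t ht x hx) (norm_nonneg _) hε0.le
    have := mul_pos hε0 hM
    linarith
  obtain ⟨α, hα, hαlip⟩ := exists_lipschitz_flow_of_norm_lt hT (by positivity) hr hVlip
    (fun x hx => (((hFcont x hx).const_smul ε).add
      ((hGcont x hx).const_smul (ε ^ 2))).continuousOn) hVM hεr
  refine ⟨α, fun z hz => ?_, hαlip⟩
  obtain ⟨h0, hd, hbd⟩ := hα z hz
  have hz2 : z ∈ closedBall a (2 * r) := closedBall_subset_closedBall (by linarith) hz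
  have hbd' : ∀ t ∈ Icc 0 T, ‖α z t - z‖ ≤ 3 * |ε| * M * T := fun t ht =>
    (hbd t ht).trans (mul_le_mul_of_nonneg_left ht.2 (by positivity))
  have hmem : ∀ t ∈ Icc 0 T, α z t ∈ closedBall a (2 * r) := by
    intro t ht
    have h1 := dist_triangle (α z t) z a
    rw [dist_eq_norm (α z t) z] at h1
    have h2 : dist z a ≤ r := hz
    have h3 := hbd' t ht
    rw [mem_closedBall]
    linarith
  refine ⟨h0, hd, hmem, ?_⟩
  have hder : ∀ t ∈ Icc 0 T,
      HasDerivWithinAt (fun t => α z t - ε • ∫ s in (0 : ℝ)..t, F s z)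
        (V t (α z t) - ε • F t z) (Icc 0 T) t := fun t ht =>
    (hd t ht).sub (((hFcont z hz2).integral_hasStrictDerivAt 0 t).hasDerivAt.const_smul
      ε).hasDerivWithinAt
  have h := norm_image_sub_le_of_norm_deriv_le_segment' hder
    (C := (3 * L * M * T + M) * ε ^ 2) (fun t ht' => by
      have ht := Ico_subset_Icc_self ht'
      have h1 : V t (α z t) - ε • F t z =
          ε • (F t (α z t) - F t z) + ε ^ 2 • G t (α z t) := by
        simp only [V]; module
      rw [h1]
      refine (norm_add_le _ _).trans ?_
      rw [norm_smul, norm_smul, Real.norm_eq_abs, Real.norm_of_nonneg (sq_nonneg ε)]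
      have h2 : |ε| * ‖F t (α z t) - F t z‖ ≤ |ε| * (L * (3 * |ε| * M * T)) := by
        have := hFlip t ht _ (hmem t ht) z hz2
        have := mul_le_mul_of_nonneg_left (hbd' t ht) hL
        gcongr
        linarith
      have h3 : ε ^ 2 * ‖G t (α z t)‖ ≤ ε ^ 2 * M :=
        mul_le_mul_of_nonneg_left (hGM t ht _ (hmem t ht)) (sq_nonneg ε)
      have h4 : |ε| * (L * (3 * |ε| * M * T)) = 3 * L * M * T * ε ^ 2 := by
        rw [← sq_abs ε]; ring
      linarith) T ⟨hT, le_rfl⟩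
  have h5 : (α z T - ε • ∫ s in (0 : ℝ)..T, F s z) -
      (α z 0 - ε • ∫ s in (0 : ℝ)..0, F s z) = α z T - z - ε • ∫ t in (0 : ℝ)..T, F t z := by
    rw [h0, intervalIntegral.integral_same, smul_zero, sub_zero]; abel
  rw [h5, sub_zero] at h
  exact h.trans_eq (by ring)

/-- A family of nonempty sets that accumulates at `a` has a selection converging to `a`. -/
theorem exists_selection_tendsto {X ι : Type*} {Y : Type*} [PseudoMetricSpace X]
    {l : Filter ι} {S : ι → Set Y} {g : Y → X} {a : X} (hY : Nonempty Y)
    (h : ∀ ρ > 0, ∀ᶠ i in l, ∃ y ∈ S i, dist (g y) a ≤ ρ) {η : ι → ℝ} (hη : Tendsto η l (nhds 0))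
    (hηpos : ∀ i, (S i).Nonempty → 0 < η i) :
    ∃ s : ι → Y, (∀ i, (S i).Nonempty → s i ∈ S i) ∧ Tendsto (fun i => g (s i)) l (nhds a) := by
  have hex : ∀ i, ∃ y : Y, (S i).Nonempty →
      y ∈ S i ∧ dist a (g y) < infDist a (g '' S i) + η i := by
    intro i
    by_cases hi : (S i).Nonempty
    · obtain ⟨_, ⟨y, hy, rfl⟩, hlt⟩ := (infDist_lt_iff (hi.image g)).1
        (lt_add_of_pos_right (infDist a (g '' S i)) (hηpos i hi))
      exact ⟨y, fun _ => ⟨hy, hlt⟩⟩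
    · exact ⟨hY.some, fun h => (hi h).elim⟩
  choose s hs using hex
  refine ⟨s, fun i hi => (hs i hi).1, Metric.tendsto_nhds.2 fun ρ hρ => ?_⟩
  filter_upwards [h (ρ / 2) (half_pos hρ), hη.eventually (gt_mem_nhds (half_pos hρ))]
    with i ⟨y, hy, hya⟩ hi
  have h1 := infDist_le_dist_of_mem (x := a) (mem_image_of_mem g hy)
  have h2 := (hs i ⟨y, hy⟩).2
  rw [dist_comm] at hya
  rw [dist_comm]
  linarith

end Averaging

/-- First-order averaging for continuous, locally Lipschitz systems: if the averaged function
`f(z) = ∫₀ᵀ F(t,z) dt` has a zero `a` at which it is differentiable with invertible derivative,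
then for every sufficiently small `ε ≠ 0` the system `x' = ε F(t,x) + ε² R(t,x,ε)` has a
`T`-periodic solution `x(·,ε)` with `x(0,ε) → a` as `ε → 0`. -/
theorem averaging_continuous_systems {n : ℕ} (T εf : ℝ) (hT : 0 < T) (hεf : 0 < εf)
    (D : Set (EuclideanSpace ℝ (Fin n))) (hD : IsOpen D)
    (F : ℝ → EuclideanSpace ℝ (Fin n) → EuclideanSpace ℝ (Fin n))
    (R : ℝ → EuclideanSpace ℝ (Fin n) → ℝ → EuclideanSpace ℝ (Fin n))
    (hFc : ContinuousOn (fun p : ℝ × EuclideanSpace ℝ (Fin n) => F p.1 p.2) (univ ×ˢ D))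
    (hRc : ContinuousOn (fun p : ℝ × EuclideanSpace ℝ (Fin n) × ℝ => R p.1 p.2.1 p.2.2)
      (univ ×ˢ D ×ˢ Ioo (-εf) εf))
    (hFper : ∀ t x, F (t + T) x = F t x)
    (hRper : ∀ t x ε, R (t + T) x ε = R t x ε)
    (hFlip : ∀ x₀ ∈ D, ∃ U ∈ nhds x₀, ∃ L : ℝ, ∀ t : ℝ, ∀ x₁ ∈ U ∩ D, ∀ x₂ ∈ U ∩ D,
      ‖F t x₁ - F t x₂‖ ≤ L * ‖x₁ - x₂‖)
    (hRlip : ∀ x₀ ∈ D, ∃ U ∈ nhds x₀, ∃ L : ℝ, ∀ t : ℝ, ∀ ε ∈ Ioo (-εf) εf,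
      ∀ x₁ ∈ U ∩ D, ∀ x₂ ∈ U ∩ D, ‖R t x₁ ε - R t x₂ ε‖ ≤ L * ‖x₁ - x₂‖)
    (a : EuclideanSpace ℝ (Fin n)) (ha : a ∈ D)
    (hfa : (∫ t in (0 : ℝ)..T, F t a) = 0)
    (Df : EuclideanSpace ℝ (Fin n) ≃L[ℝ] EuclideanSpace ℝ (Fin n))
    (hdf : HasFDerivAt (fun z => ∫ t in (0 : ℝ)..T, F t z)
      (Df : EuclideanSpace ℝ (Fin n) →L[ℝ] EuclideanSpace ℝ (Fin n)) a) :
    ∃ ε₁ ∈ Ioo (0 : ℝ) εf, ∃ sol : ℝ → ℝ → EuclideanSpace ℝ (Fin n),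
      (∀ ε : ℝ, 0 < |ε| → |ε| < ε₁ →
        (∀ t, sol ε t ∈ D) ∧ Function.Periodic (sol ε) T ∧
        ∀ t : ℝ, HasDerivAt (sol ε) (ε • F t (sol ε t) + ε ^ 2 • R t (sol ε t) ε) t) ∧
      Tendsto (fun ε => sol ε 0) (nhdsWithin 0 {ε : ℝ | ε ≠ 0}) (nhds a) := by
  obtain ⟨U₁, hU₁, L₁, hL₁⟩ := hFlip a ha
  obtain ⟨U₂, hU₂, L₂, hL₂⟩ := hRlip a ha
  obtain ⟨d, hd, hball⟩ := Metric.nhds_basis_closedBall.mem_iff.1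
    (inter_mem (inter_mem hU₁ hU₂) (hD.mem_nhds ha))
  set r := d / 2
  have hr : 0 < r := half_pos hd
  have h2r : 2 * r = d := mul_div_cancel₀ d two_ne_zero
  rw [← h2r] at hball
  set L := max (max L₁ L₂) 0
  have hL : 0 ≤ L := le_max_right _ _
  have hBD : Metric.closedBall a (2 * r) ⊆ D := fun x hx => (hball hx).2
  have hcB := isCompact_closedBall a (2 * r)
  obtain ⟨M₁, hM₁⟩ := ((isCompact_Icc (a := (0 : ℝ)) (b := T)).prod hcB).exists_bound_of_continuousOn
    (hFc.mono (prod_mono (subset_univ _) hBD))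
  obtain ⟨M₂, hM₂⟩ := ((isCompact_Icc (a := (0 : ℝ)) (b := T)).prod
    (hcB.prod (isCompact_Icc (a := -(εf / 2)) (b := εf / 2)))).exists_bound_of_continuousOn
    (hRc.mono (prod_mono (subset_univ _) (prod_mono hBD
      (Icc_subset_Ioo (by linarith) (by linarith)))))
  set M := max (max M₁ M₂) 1
  have hM : 0 < M := lt_max_of_lt_right one_pos
  set C := (3 * L * M * T + M) * T
  have hC : 0 ≤ C := by positivity
  set e₀ := min (min 1 (εf / 2)) (r / (3 * M * T))
  have he₀ : 0 < e₀ := by positivity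
  set S : ℝ → Set (ℝ → EuclideanSpace ℝ (Fin n)) := fun ε =>
    {x | (∀ t, x t ∈ D) ∧ Function.Periodic x T ∧
      ∀ t : ℝ, HasDerivAt x (ε • F t (x t) + ε ^ 2 • R t (x t) ε) t}
  have hS : ∀ ρ > 0, ∃ δ > 0, ∀ ε : ℝ, 0 < |ε| → |ε| < δ → ∃ x ∈ S ε, dist (x 0) a ≤ ρ := by
    intro ρ hρ
    obtain ⟨δ, hδ, hfix⟩ := exists_fixedPoint_of_norm_sub_le (a := a)
      (f := fun z => ∫ t in (0 : ℝ)..T, F t z) Df hfa hdf hC hr hρ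
    refine ⟨min δ e₀, lt_min hδ he₀, fun ε hε0 hε => ?_⟩
    have hεδ : |ε| < δ := hε.trans_le (min_le_left _ _)
    have hεe : |ε| ≤ e₀ := (hε.trans_le (min_le_right _ _)).le
    have hε1 : |ε| ≤ 1 := hεe.trans ((min_le_left _ _).trans (min_le_left _ _))
    have hεf2 : |ε| ≤ εf / 2 := hεe.trans ((min_le_left _ _).trans (min_le_right _ _))
    have hεr : 3 * |ε| * M * T ≤ r := by
      have := hεe.trans (min_le_right _ _)
      rw [le_div_iff₀ (by positivity)] at this
      linarith
    have hεmem : ε ∈ Ioo (-εf) εf := abs_lt.1 (by linarith)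
    obtain ⟨α, hα, K, hK⟩ := exists_flow_norm_sub_le (F := F) (G := fun t x => R t x ε) (a := a)
      hT.le hM hL hr.le
      (fun t _ x hx y hy => (hL₁ t x ⟨(hball hx).1.1, hBD hx⟩ y ⟨(hball hy).1.1, hBD hy⟩).trans
        (mul_le_mul_of_nonneg_right ((le_max_left _ _).trans (le_max_left _ _)) (norm_nonneg _)))
      (fun t _ x hx y hy =>
        (hL₂ t ε hεmem x ⟨(hball hx).1.2, hBD hx⟩ y ⟨(hball hy).1.2, hBD hy⟩).trans
        (mul_le_mul_of_nonneg_right ((le_max_right _ _).trans (le_max_left _ _)) (norm_nonneg _)))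
      (fun x hx => hFc.comp_continuous (f := fun t : ℝ => (t, x)) (by fun_prop)
        (fun t => ⟨mem_univ _, hBD hx⟩))
      (fun x hx => hRc.comp_continuous (f := fun t : ℝ => (t, x, ε)) (by fun_prop)
        (fun t => ⟨mem_univ _, hBD hx, hεmem⟩))
      (fun t ht x hx => (hM₁ (t, x) ⟨ht, hx⟩).trans
        ((le_max_left _ _).trans (le_max_left _ _)))
      (fun t ht x hx => (hM₂ (t, x, ε) ⟨ht, hx, abs_le.1 hεf2⟩).trans
        ((le_max_right _ _).trans (le_max_left _ _)))
      hε0 hε1 hεr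
    obtain ⟨z, hz, hza, hzP⟩ := hfix ε hε0 hεδ (fun z => α z T) K hK
      (fun z hz => (hα z hz).2.2.2)
    obtain ⟨h0, hder, hmem, -⟩ := hα z hz
    obtain ⟨x, hx0, hxmem, hxper, hxder⟩ := exists_periodic_solution
      (V := fun t x => ε • F t x + ε ^ 2 • R t x ε) hT
      (fun t x => by simp only [hFper, hRper]) hder (by rw [h0]; exact hzP)
    refine ⟨x, ⟨fun t => ?_, hxper, hxder⟩, by rwa [hx0, h0]⟩
    obtain ⟨s, hs, hsx⟩ := hxmem t
    exact hsx ▸ hBD (hmem s hs)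
  obtain ⟨sol, hsol, hlim⟩ := exists_selection_tendsto (l := nhdsWithin (0 : ℝ) {ε : ℝ | ε ≠ 0})
    (S := fun ε => {x ∈ S ε | ε ≠ 0}) (g := fun x => x 0) (a := a) ⟨fun _ => a⟩ (fun ρ hρ => by
      obtain ⟨δ, hδ, hδS⟩ := hS ρ hρ
      filter_upwards [self_mem_nhdsWithin,
        mem_nhdsWithin_of_mem_nhds (Metric.ball_mem_nhds (0 : ℝ) hδ)] with ε hε hεδ
      obtain ⟨x, hx, hxa⟩ := hδS ε (abs_pos.2 hε) (by simpa using hεδ)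
      exact ⟨x, ⟨hx, hε⟩, hxa⟩) (η := fun ε => |ε|)
    ((continuous_abs.tendsto' 0 0 abs_zero).mono_left nhdsWithin_le_nhds)
    (fun ε ⟨x, hx⟩ => abs_pos.2 hx.2)
  obtain ⟨δ, hδ, hδS⟩ := hS 1 one_pos
  refine ⟨min δ (εf / 2), ⟨by positivity, (min_le_right _ _).trans_lt (by linarith)⟩, sol,
    fun ε hε0 hε => ?_, hlim⟩
  obtain ⟨x, hx, -⟩ := hδS ε hε0 (hε.trans_le (min_le_left _ _))
  exact (hsol ε ⟨x, hx, abs_pos.1 hε0⟩).1
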